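/- Let g ≥ 2 and consider F(x) = (1−ux)^(g−1)(1−vx)^(g−1) / (x^(2g−4)(1−x^2)(1−x)(1−uvx)) over K = ℚ(u,v). Then the residue of F at the double pole x = 1 equals −((g−1)/2)·(u+v−2uv)(1−u)^(g−2)(1−v)^(g−2)/(1−uv) − ((4g−7)/4)·(1−u)^(g−1)(1−v)^(g−1)/(1−uv) + uv(1−u)^(g−1)(1−v)^(g−1)/(2(uv−1)^2). -/

import Mathlib

open RatFunc

/-- A polynomial vanishing at `a` together with its derivative is divisible by `(X - a) ^ 2`. -/
theorem sq_X_sub_C_dvd_of_isRoot_derivative {K : Type*} [Field K] {W : Polynomial K} {a : K}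
    (h : W.IsRoot a) (h' : W.derivative.IsRoot a) :
    (Polynomial.X - Polynomial.C a) ^ 2 ∣ W := by
  obtain ⟨V, rfl⟩ := Polynomial.dvd_iff_isRoot.mpr h
  have hV : V.IsRoot a := by simpa [Polynomial.derivative_mul] using h'
  rw [sq]
  exact mul_dvd_mul_left _ (Polynomial.dvd_iff_isRoot.mpr hV)

/-- The polar part of `P / ((X - a) ^ 2 * Q)` at `a`, where `Q` does not vanish at `a`. -/
theorem exists_polar_part_of_double_pole {K : Type*} [Field K] (P Q : Polynomial K) (a : K)
    (hQ : Q.eval a ≠ 0) :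
    ∃ (c : K) (G : RatFunc K), Polynomial.eval a G.denom ≠ 0 ∧
      algebraMap (Polynomial K) (RatFunc K) P /
          ((RatFunc.X - RatFunc.C a) ^ 2 * algebraMap (Polynomial K) (RatFunc K) Q) =
        RatFunc.C c / (RatFunc.X - RatFunc.C a) ^ 2 +
          RatFunc.C ((P.derivative.eval a * Q.eval a - P.eval a * Q.derivative.eval a) /
            Q.eval a ^ 2) / (RatFunc.X - RatFunc.C a) + G := by
  set c := P.eval a / Q.eval a with hc
  set r := (P.derivative.eval a * Q.eval a - P.eval a * Q.derivative.eval a) / Q.eval a ^ 2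
    with hr
  obtain ⟨S, hS⟩ : (Polynomial.X - Polynomial.C a) ^ 2 ∣
      P - (Polynomial.C c + Polynomial.C r * (Polynomial.X - Polynomial.C a)) * Q := by
    apply sq_X_sub_C_dvd_of_isRoot_derivative
    · simp [hc, hQ]
    · simp only [Polynomial.IsRoot.def, Polynomial.derivative_sub, Polynomial.derivative_mul,
        Polynomial.derivative_add, Polynomial.derivative_C, Polynomial.derivative_X,
        Polynomial.eval_sub, Polynomial.eval_mul, Polynomial.eval_add, Polynomial.eval_C,
        Polynomial.eval_X, Polynomial.eval_zero, Polynomial.eval_one, hc, hr]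
      field_simp
      ring
  have hQ0 : Q ≠ 0 := by
    rintro rfl
    simp at hQ
  have hQ' : algebraMap (Polynomial K) (RatFunc K) Q ≠ 0 := RatFunc.algebraMap_ne_zero hQ0
  have hX : (RatFunc.X - RatFunc.C a : RatFunc K) ≠ 0 := by
    have := RatFunc.algebraMap_ne_zero (Polynomial.X_sub_C_ne_zero a)
    simpa using this
  refine ⟨c, algebraMap (Polynomial K) (RatFunc K) S / algebraMap (Polynomial K) (RatFunc K) Q,
    fun h => hQ ?_, ?_⟩
  · exact Polynomial.eval_eq_zero_of_dvd_of_eval_eq_zero (RatFunc.denom_div_dvd S Q) h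
  · have hP := congrArg (algebraMap (Polynomial K) (RatFunc K)) (sub_eq_iff_eq_add.mp hS)
    simp only [map_add, map_mul, map_sub, map_pow, RatFunc.algebraMap_X,
      RatFunc.algebraMap_C] at hP
    rw [hP]
    field_simp
    ring

/-- The residue computation over an arbitrary field in which `2 ≠ 0` and `u * v ≠ 1`, with
exponents written in terms of `m = g - 2`. -/
theorem exists_polar_part_at_one {K : Type*} [Field K] (u v : K) (h2 : (2 : K) ≠ 0)
    (huv : 1 - u * v ≠ 0) (m : ℕ) :
    ∃ (c : K) (G : RatFunc K), Polynomial.eval 1 G.denom ≠ 0 ∧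
      (1 - RatFunc.C u * RatFunc.X) ^ (m + 1) * (1 - RatFunc.C v * RatFunc.X) ^ (m + 1) /
        (RatFunc.X ^ (2 * m) * (1 - RatFunc.X ^ 2) * (1 - RatFunc.X) *
          (1 - RatFunc.C (u * v) * RatFunc.X)) =
      RatFunc.C c / (RatFunc.X - 1) ^ 2 +
        RatFunc.C (-(((m : K) + 1) / 2) * (u + v - 2 * u * v) * (1 - u) ^ m * (1 - v) ^ m /
              (1 - u * v)
            - ((4 * (m : K) + 1) / 4) * (1 - u) ^ (m + 1) * (1 - v) ^ (m + 1) / (1 - u * v)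
            + u * v * (1 - u) ^ (m + 1) * (1 - v) ^ (m + 1) / (2 * (u * v - 1) ^ 2)) /
          (RatFunc.X - 1) + G := by
  let P : Polynomial K := (1 - Polynomial.C u * Polynomial.X) ^ (m + 1) *
    (1 - Polynomial.C v * Polynomial.X) ^ (m + 1)
  let Q : Polynomial K := Polynomial.X ^ (2 * m) * (1 + Polynomial.X) *
    (1 - Polynomial.C (u * v) * Polynomial.X)
  have hP : P.eval 1 = (1 - u) ^ (m + 1) * (1 - v) ^ (m + 1) := by simp [P]
  have hP' : P.derivative.eval 1 =
      -((m + 1) * (u + v - 2 * u * v) * (1 - u) ^ m * (1 - v) ^ m) := by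
    simp [P, Polynomial.derivative_mul, Polynomial.derivative_pow]
    ring
  have hQ : Q.eval 1 = 2 * (1 - u * v) := by simp [Q, one_add_one_eq_two]
  have hQ' : Q.derivative.eval 1 = 4 * m + 1 - (4 * m + 3) * (u * v) := by
    simp [Q, Polynomial.derivative_mul, Polynomial.derivative_X_pow]
    ring
  obtain ⟨c, G, hG, h⟩ :=
    exists_polar_part_of_double_pole P Q 1 (by rw [hQ]; exact mul_ne_zero h2 huv)
  refine ⟨c, G, hG, ?_⟩
  rw [hP, hP', hQ, hQ', map_one] at h
  convert h using 1
  · congr 1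
    · simp [P]
    · simp only [Q, map_mul, map_sub, map_add, map_pow, map_one, RatFunc.algebraMap_X,
        RatFunc.algebraMap_C]
      ring
  · congr 4
    have huv' : (u * v - 1) ^ 2 = (1 - u * v) ^ 2 := by ring
    have h4 : (4 : K) = 2 * 2 := by norm_num
    rw [huv', h4]
    field_simp
    ring

/-- The residue at the double pole `x = 1` of
`F(x) = (1−ux)^(g−1)(1−vx)^(g−1)/(x^(2g−4)(1−x²)(1−x)(1−uvx))` over `ℚ(u,v)`
equals `−((g−1)/2)(u+v−2uv)(1−u)^(g−2)(1−v)^(g−2)/(1−uv)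
−((4g−7)/4)(1−u)^(g−1)(1−v)^(g−1)/(1−uv) + uv(1−u)^(g−1)(1−v)^(g−1)/(2(uv−1)²)`.
The residue at a double pole `a` is the coefficient of `(x−a)⁻¹` in the Laurent
expansion: `F = c/(X−a)² + r/(X−a) + G` with `G` regular at `a`. -/
theorem residue_at_one (g : ℕ) (hg : 2 ≤ g) :
    let K := FractionRing (MvPolynomial (Fin 2) ℚ)
    let u : K := algebraMap (MvPolynomial (Fin 2) ℚ) K (MvPolynomial.X 0)
    let v : K := algebraMap (MvPolynomial (Fin 2) ℚ) K (MvPolynomial.X 1)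
    let F : RatFunc K :=
      (1 - RatFunc.C u * RatFunc.X) ^ (g - 1) * (1 - RatFunc.C v * RatFunc.X) ^ (g - 1) /
        (RatFunc.X ^ (2 * g - 4) * (1 - RatFunc.X ^ 2) * (1 - RatFunc.X) *
          (1 - RatFunc.C (u * v) * RatFunc.X))
    let r : K :=
      -(((g : K) - 1) / 2) * (u + v - 2 * u * v) * (1 - u) ^ (g - 2) * (1 - v) ^ (g - 2) /
          (1 - u * v)
        - ((4 * (g : K) - 7) / 4) * (1 - u) ^ (g - 1) * (1 - v) ^ (g - 1) / (1 - u * v)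
        + u * v * (1 - u) ^ (g - 1) * (1 - v) ^ (g - 1) / (2 * (u * v - 1) ^ 2)
    ∃ (c : K) (G : RatFunc K), Polynomial.eval 1 G.denom ≠ 0 ∧
      F = RatFunc.C c / (RatFunc.X - 1) ^ 2 + RatFunc.C r / (RatFunc.X - 1) + G := by
  intro K u v F r
  obtain ⟨m, rfl⟩ := Nat.exists_eq_add_of_le' hg
  have huv : 1 - u * v ≠ 0 := by
    intro h
    have h1 : (1 : MvPolynomial (Fin 2) ℚ) - MvPolynomial.X 0 * MvPolynomial.X 1 = 0 := by
      apply IsFractionRing.injective (MvPolynomial (Fin 2) ℚ) K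
      simpa [u, v] using h
    simpa using congrArg (MvPolynomial.eval 0) h1
  obtain ⟨c, G, hG, h⟩ := exists_polar_part_at_one u v two_ne_zero huv m
  refine ⟨c, G, hG, ?_⟩
  have hr : r = -(((m : K) + 1) / 2) * (u + v - 2 * u * v) * (1 - u) ^ m * (1 - v) ^ m /
        (1 - u * v)
      - ((4 * (m : K) + 1) / 4) * (1 - u) ^ (m + 1) * (1 - v) ^ (m + 1) / (1 - u * v)
      + u * v * (1 - u) ^ (m + 1) * (1 - v) ^ (m + 1) / (2 * (u * v - 1) ^ 2) := by
    have e1 : ((m + 2 : ℕ) : K) - 1 = m + 1 := by push_cast; ring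
    have e2 : 4 * ((m + 2 : ℕ) : K) - 7 = 4 * m + 1 := by push_cast; ring
    simp only [r, e1, e2, Nat.add_sub_cancel, show m + 2 - 1 = m + 1 from rfl]
  rw [hr, ← h]
  simp only [F, show m + 2 - 1 = m + 1 from rfl, show 2 * (m + 2) - 4 = 2 * m by lia]
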